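/- Fix a matrix G ∈ ℝ^{n×n} with each node having q neighbors, fix constants L, B, D, R > 0, and let F be the class of two-layer GCN outputs f(x_i) = σ(∑_{t=1}^k w_t^{(2)} ∑_{v ∈ N(i)} G_{iv} σ(∑_{j ∈ N(v)} G_{vj} ⟨x_j, w_t^{(1)}⟩)) with ‖W^{(1)}‖_F ≤ R, ‖w^{(2)}‖₂ ≤ D, σ L-Lipschitz, positively homogeneous, σ(0)=0, and ‖x_j‖₂ ≤ B for all j. If G is symmetric with largest absolute eigenvalue λ, then the empirical Rademacher complexity on any m labeled nodes satisfies R̂(F) ≤ 8 L² B D R λ √(q/m) ∑_{l=1}^q max_{j ∈ [m]} |G_{j, n_l(j)}|, where n_l(j) is the l-th neighbor of node j in a fixed ordering. -/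

import Mathlib

open scoped RealInnerProductSpace

/-- A sign vector built from a Boolean choice: the canonical model of a tuple of
independent Rademacher variables. -/
def signVec (m : ℕ) (s : Fin m → Bool) : Fin m → ℝ :=
  fun i => if s i then 1 else -1

/-- Expectation over `m` i.i.d. Rademacher variables (uniform average over all
`2^m` sign patterns). -/
noncomputable def radE (m : ℕ) (F : (Fin m → ℝ) → ℝ) : ℝ :=
  (∑ s : Fin m → Bool, F (signVec m s)) / 2 ^ m

/-! ### Bounded real functions -/

/-- A real-valued function with bounded absolute value. -/
def IsBddFun {P : Type*} (f : P → ℝ) : Prop := ∃ C, ∀ p, |f p| ≤ C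

namespace IsBddFun

variable {P : Type*} {f g : P → ℝ}

theorem bddAbove (hf : IsBddFun f) : BddAbove (Set.range f) := by
  obtain ⟨C, hC⟩ := hf
  exact ⟨C, by rintro _ ⟨p, rfl⟩; exact (le_abs_self _).trans (hC p)⟩

theorem abs (hf : IsBddFun f) : IsBddFun fun p => |f p| := by
  obtain ⟨C, hC⟩ := hf
  exact ⟨C, fun p => by simpa using hC p⟩

theorem neg (hf : IsBddFun f) : IsBddFun fun p => -f p := by
  obtain ⟨C, hC⟩ := hf
  exact ⟨C, fun p => by simpa using hC p⟩

theorem add (hf : IsBddFun f) (hg : IsBddFun g) : IsBddFun fun p => f p + g p := by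
  obtain ⟨C, hC⟩ := hf
  obtain ⟨C', hC'⟩ := hg
  exact ⟨C + C', fun p => (abs_add_le _ _).trans (add_le_add (hC p) (hC' p))⟩

theorem mul (hf : IsBddFun f) (hg : IsBddFun g) : IsBddFun fun p => f p * g p := by
  obtain ⟨C, hC⟩ := hf
  obtain ⟨C', hC'⟩ := hg
  refine ⟨C * C', fun p => ?_⟩
  rw [abs_mul]
  exact mul_le_mul (hC p) (hC' p) (abs_nonneg _) ((abs_nonneg _).trans (hC p))

theorem const_mul (c : ℝ) (hf : IsBddFun f) : IsBddFun fun p => c * f p :=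
  mul ⟨|c|, fun _ => le_rfl⟩ hf

theorem sum {ι : Type*} (t : Finset ι) {F : P → ι → ℝ} (hF : ∀ i, IsBddFun fun p => F p i) :
    IsBddFun fun p => ∑ i ∈ t, F p i := by
  choose C hC using hF
  exact ⟨∑ i ∈ t, C i, fun p =>
    (Finset.abs_sum_le_sum_abs _ _).trans (Finset.sum_le_sum fun i _ => hC i p)⟩

theorem of_abs_le_mul {L : ℝ} (hL : 0 ≤ L) (hf : IsBddFun f) (h : ∀ p, |g p| ≤ L * |f p|) :
    IsBddFun g := by
  obtain ⟨C, hC⟩ := hf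
  exact ⟨L * C, fun p => (h p).trans (mul_le_mul_of_nonneg_left (hC p) hL)⟩

end IsBddFun

/-! ### Elementary properties of the Rademacher average -/

theorem radE_mono {m : ℕ} {F H : (Fin m → ℝ) → ℝ} (h : ∀ ε, F ε ≤ H ε) :
    radE m F ≤ radE m H := by
  unfold radE
  gcongr
  exact h _

theorem radE_const_mul {m : ℕ} (c : ℝ) (F : (Fin m → ℝ) → ℝ) :
    radE m (fun ε => c * F ε) = c * radE m F := by
  simp only [radE, ← Finset.mul_sum, mul_div_assoc]

theorem radE_sum {m : ℕ} {ι : Type*} (t : Finset ι) (F : ι → (Fin m → ℝ) → ℝ) :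
    radE m (fun ε => ∑ i ∈ t, F i ε) = ∑ i ∈ t, radE m (F i) := by
  simp only [radE, ← Finset.sum_div]
  rw [Finset.sum_comm]

theorem radE_add {m : ℕ} (F H : (Fin m → ℝ) → ℝ) :
    radE m (fun ε => F ε + H ε) = radE m F + radE m H := by
  simp only [radE, Finset.sum_add_distrib, add_div]

theorem signVec_not {m : ℕ} (s : Fin m → Bool) :
    signVec m (fun i => !s i) = fun i => -signVec m s i := by
  funext i
  cases h : s i <;> simp [signVec, h]

theorem radE_neg {m : ℕ} (F : (Fin m → ℝ) → ℝ) :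
    radE m (fun ε => F (fun i => -ε i)) = radE m F := by
  unfold radE
  congr 1
  refine Fintype.sum_equiv (Equiv.arrowCongr (Equiv.refl _) Equiv.boolNot) _ _ fun s => ?_
  exact congrArg F (signVec_not s).symm

theorem sum_signVec_succ {m : ℕ} (H : (Fin (m + 1) → ℝ) → ℝ) :
    ∑ s : Fin (m + 1) → Bool, H (signVec (m + 1) s) =
      ∑ s : Fin m → Bool,
        (H (Fin.cons 1 (signVec m s)) + H (Fin.cons (-1) (signVec m s))) := by
  rw [← (Fin.consEquiv fun _ : Fin (m + 1) => Bool).sum_comp, Fintype.sum_prod_type,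
    Fintype.sum_bool, ← Finset.sum_add_distrib]
  refine Finset.sum_congr rfl fun s _ => ?_
  congr 2 <;> funext i <;> refine Fin.cases ?_ (fun i => ?_) i <;>
    simp [signVec, Fin.consEquiv]

/-! ### The contraction principle -/

theorem iSup_add_iSup_sub_le {P : Type*} [Nonempty P] {a u v : P → ℝ} (ha : IsBddFun a)
    (hv : IsBddFun v) (huv : ∀ p p', |u p - u p'| ≤ |v p - v p'|) :
    (⨆ p, (a p + u p)) + (⨆ p, (a p - u p)) ≤ (⨆ p, (a p + v p)) + ⨆ p, (a p - v p) := by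
  have hplus : BddAbove (Set.range fun p => a p + v p) := (ha.add hv).bddAbove
  have hminus : BddAbove (Set.range fun p => a p - v p) := by
    simpa only [sub_eq_add_neg] using (ha.add hv.neg).bddAbove
  refine ciSup_add_ciSup_le fun p p' => ?_
  have h := (le_abs_self _).trans (huv p p')
  have h₁ := le_ciSup hplus p
  have h₂ := le_ciSup hminus p'
  have h₃ := le_ciSup hplus p'
  have h₄ := le_ciSup hminus p
  rcases abs_cases (v p - v p') with ⟨e, _⟩ | ⟨e, _⟩ <;> rw [e] at h <;> linarith

theorem sum_iSup_signVec_le {P : Type*} [Nonempty P] {m : ℕ} (a : P → ℝ) (u v : P → Fin m → ℝ)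
    (ha : IsBddFun a) (hu : ∀ j, IsBddFun fun p => u p j) (hv : ∀ j, IsBddFun fun p => v p j)
    (huv : ∀ j p p', |u p j - u p' j| ≤ |v p j - v p' j|) :
    ∑ s : Fin m → Bool, ⨆ p, (a p + ∑ j, signVec m s j * u p j) ≤
      ∑ s : Fin m → Bool, ⨆ p, (a p + ∑ j, signVec m s j * v p j) := by
  induction m generalizing a with
  | zero => simp
  | succ m ih =>
    rw [sum_signVec_succ fun ε => ⨆ p, (a p + ∑ j, ε j * u p j),
      sum_signVec_succ fun ε => ⨆ p, (a p + ∑ j, ε j * v p j)]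
    simp only [Fin.sum_univ_succ, Fin.cons_zero, Fin.cons_succ, one_mul, neg_one_mul]
    have step : ∀ s : Fin m → Bool,
        (⨆ p, (a p + (u p 0 + ∑ j : Fin m, signVec m s j * u p j.succ))) +
          (⨆ p, (a p + (-u p 0 + ∑ j : Fin m, signVec m s j * u p j.succ))) ≤
        (⨆ p, ((a p + v p 0) + ∑ j : Fin m, signVec m s j * u p j.succ)) +
          (⨆ p, ((a p + -v p 0) + ∑ j : Fin m, signVec m s j * u p j.succ)) := by
      intro s
      have h := iSup_add_iSup_sub_le
        (a := fun p => a p + ∑ j : Fin m, signVec m s j * u p j.succ)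
        (ha.add (IsBddFun.sum _ fun j => (hu j.succ).const_mul _)) (hv 0) (huv 0)
      convert h using 4 <;> ring
    refine (Finset.sum_le_sum fun s _ => step s).trans ?_
    simp only [← add_assoc]
    rw [Finset.sum_add_distrib, Finset.sum_add_distrib]
    exact add_le_add
      (ih _ (fun p j => u p j.succ) (fun p j => v p j.succ) (ha.add (hv 0))
        (fun j => hu j.succ) (fun j => hv j.succ) fun j => huv j.succ)
      (ih _ (fun p j => u p j.succ) (fun p j => v p j.succ) (ha.add (hv 0).neg)
        (fun j => hu j.succ) (fun j => hv j.succ) fun j => huv j.succ)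

theorem radE_iSup_abs_le {P : Type*} {m : ℕ} (u v : P → Fin m → ℝ)
    (hu : ∀ j, IsBddFun fun p => u p j) (hv : ∀ j, IsBddFun fun p => v p j)
    (huv : ∀ j p p', |u p j - u p' j| ≤ |v p j - v p' j|) (p₀ : P) (hp₀ : ∀ j, u p₀ j = 0) :
    radE m (fun ε => ⨆ p, |∑ j, ε j * u p j|) ≤
      2 * radE m (fun ε => ⨆ p, |∑ j, ε j * v p j|) := by
  have : Nonempty P := ⟨p₀⟩
  have bdd : ∀ (w : P → Fin m → ℝ), (∀ j, IsBddFun fun p => w p j) → ∀ ε : Fin m → ℝ,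
      IsBddFun fun p => ∑ j, ε j * w p j :=
    fun w hw ε => IsBddFun.sum _ fun j => (hw j).const_mul _
  have nonneg : ∀ ε : Fin m → ℝ, 0 ≤ ⨆ p, ∑ j, ε j * u p j := fun ε =>
    le_ciSup_of_le (bdd u hu ε).bddAbove p₀ (by simp [hp₀])
  have split : radE m (fun ε => ⨆ p, |∑ j, ε j * u p j|) ≤
      radE m (fun ε => (⨆ p, ∑ j, ε j * u p j) + ⨆ p, ∑ j, -ε j * u p j) := by
    refine radE_mono fun ε => ciSup_le fun p => ?_
    have h₁ := le_ciSup (bdd u hu ε).bddAbove p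
    have h₂ := le_ciSup (bdd u hu fun j => -ε j).bddAbove p
    have h₃ := nonneg ε
    have h₄ := nonneg fun j => -ε j
    simp only [neg_mul, Finset.sum_neg_distrib] at h₁ h₂ h₃ h₄ ⊢
    exact abs_le'.2 ⟨by linarith, by linarith⟩
  have contract : radE m (fun ε => ⨆ p, ∑ j, ε j * u p j) ≤
      radE m (fun ε => ⨆ p, ∑ j, ε j * v p j) := by
    have h := sum_iSup_signVec_le (fun _ => 0) u v ⟨0, by simp⟩ hu hv huv
    simp only [zero_add] at h
    exact div_le_div_of_nonneg_right h (by positivity)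
  have le_abs : radE m (fun ε => ⨆ p, ∑ j, ε j * v p j) ≤
      radE m (fun ε => ⨆ p, |∑ j, ε j * v p j|) :=
    radE_mono fun ε => ciSup_mono (bdd v hv ε).abs.bddAbove fun p => le_abs_self _
  rw [radE_add, radE_neg fun ε => ⨆ p, ∑ j, ε j * u p j] at split
  linarith

/-! ### Rademacher sums in an inner product space -/

theorem sum_norm_sq_signVec {E : Type*} [NormedAddCommGroup E] [InnerProductSpace ℝ E] {m : ℕ}
    (z : E) (y : Fin m → E) :
    ∑ s : Fin m → Bool, ‖z + ∑ j, signVec m s j • y j‖ ^ 2 =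
      2 ^ m * (‖z‖ ^ 2 + ∑ j, ‖y j‖ ^ 2) := by
  induction m generalizing z with
  | zero => simp
  | succ m ih =>
    rw [sum_signVec_succ fun ε => ‖z + ∑ j, ε j • y j‖ ^ 2]
    simp only [Fin.sum_univ_succ, Fin.cons_zero, Fin.cons_succ, one_smul, neg_smul, ← add_assoc]
    rw [Finset.sum_add_distrib, ih (z + y 0) fun j => y j.succ,
      ih (z + -y 0) fun j => y j.succ, ← sub_eq_add_neg]
    have h := parallelogram_law_with_norm ℝ z (y 0)
    rw [pow_succ]
    linear_combination 2 ^ m * h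

theorem radE_norm_sum_le {E : Type*} [NormedAddCommGroup E] [InnerProductSpace ℝ E] {m : ℕ}
    (y : Fin m → E) {C : ℝ} (hC : 0 ≤ C) (hy : ∀ j, ‖y j‖ ≤ C) :
    radE m (fun ε => ‖∑ j, ε j • y j‖) ≤ Real.sqrt m * C := by
  have hsq := sum_norm_sq_signVec 0 y
  have hcs := sq_sum_le_card_mul_sum_sq (s := (Finset.univ : Finset (Fin m → Bool)))
    (f := fun s => ‖∑ j, signVec m s j • y j‖)
  simp only [zero_add, norm_zero, ne_eq, OfNat.ofNat_ne_zero, not_false_eq_true, zero_pow] at hsq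
  rw [hsq] at hcs
  have hsum : ∑ j, ‖y j‖ ^ 2 ≤ m * C ^ 2 := by
    refine (Finset.sum_le_card_nsmul _ _ (C ^ 2) fun j _ => ?_).trans (by simp)
    exact pow_le_pow_left₀ (norm_nonneg _) (hy j) 2
  unfold radE
  rw [div_le_iff₀ (by positivity)]
  refine abs_le_of_sq_le_sq' ?_ (by positivity) |>.2
  refine hcs.trans ?_
  rw [mul_pow, mul_pow, Real.sq_sqrt (Nat.cast_nonneg _)]
  simp only [Finset.card_univ, Fintype.card_fun, Fintype.card_bool, Fintype.card_fin,
    Nat.cast_pow, Nat.cast_ofNat]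
  calc (2 : ℝ) ^ m * (2 ^ m * ∑ j, ‖y j‖ ^ 2) ≤ 2 ^ m * (2 ^ m * (m * C ^ 2)) := by gcongr
    _ = _ := by ring

/-! ### Graph aggregation -/

theorem Matrix.IsSymm.sum_row_sq_le {n : ℕ} {G : Matrix (Fin n) (Fin n) ℝ} (hG : G.IsSymm)
    (v : Fin n) : ∑ u, G v u ^ 2 ≤ ‖Matrix.toEuclideanCLM (𝕜 := ℝ) G‖ ^ 2 := by
  have h := (Matrix.toEuclideanCLM (𝕜 := ℝ) G).le_opNorm (EuclideanSpace.single v 1)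
  rw [PiLp.norm_single, norm_one, mul_one] at h
  have h' := pow_le_pow_left₀ (norm_nonneg _) h 2
  rw [EuclideanSpace.norm_sq_eq] at h'
  refine le_trans (le_of_eq (Finset.sum_congr rfl fun u _ => ?_)) h'
  simp [Matrix.ofLp_toEuclideanCLM, hG.apply u v]

theorem norm_aggregate_le {n q : ℕ} {E : Type*} [NormedAddCommGroup E] [NormedSpace ℝ E]
    {G : Matrix (Fin n) (Fin n) ℝ} (hG : G.IsSymm) {N : Finset (Fin n)} (hN : N.card = q)
    {x : Fin n → E} {B : ℝ} (hB : 0 ≤ B) (hx : ∀ j, ‖x j‖ ≤ B) (v : Fin n) :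
    ‖∑ u ∈ N, G v u • x u‖ ≤ Real.sqrt q * ‖Matrix.toEuclideanCLM (𝕜 := ℝ) G‖ * B := by
  have hsum : ∑ u ∈ N, |G v u| ≤ Real.sqrt q * ‖Matrix.toEuclideanCLM (𝕜 := ℝ) G‖ := by
    refine abs_le_of_sq_le_sq' ?_ (by positivity) |>.2
    have h := sq_sum_le_card_mul_sum_sq (s := N) (f := fun u => |G v u|)
    simp only [sq_abs, hN] at h
    rw [mul_pow, Real.sq_sqrt (Nat.cast_nonneg _)]
    refine h.trans (mul_le_mul_of_nonneg_left ?_ (Nat.cast_nonneg _))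
    exact (Finset.sum_le_sum_of_subset_of_nonneg (Finset.subset_univ _)
      fun _ _ _ => sq_nonneg _).trans (hG.sum_row_sq_le v)
  calc ‖∑ u ∈ N, G v u • x u‖ ≤ ∑ u ∈ N, |G v u| * B := by
        refine norm_sum_le_of_le _ fun u _ => ?_
        rw [norm_smul, Real.norm_eq_abs]
        exact mul_le_mul_of_nonneg_left (hx u) (abs_nonneg _)
    _ = (∑ u ∈ N, |G v u|) * B := (Finset.sum_mul _ _ _).symm
    _ ≤ _ := mul_le_mul_of_nonneg_right hsum hB

theorem sum_eq_sum_enumeration {α : Type*} [DecidableEq α] {q : ℕ} {N : Finset α}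
    (hN : N.card = q) (e : Fin q → α) (he : ∀ v, v ∈ N ↔ ∃ l, e l = v) (F : α → ℝ) :
    ∑ v ∈ N, F v = ∑ l, F (e l) := by
  have himage : N = Finset.univ.image e := by
    ext v
    simp [he]
  have hinj : Set.InjOn e (Finset.univ : Finset (Fin q)) := by
    rw [← Finset.card_image_iff, ← himage, hN, Finset.card_univ, Fintype.card_fin]
  rw [himage, Finset.sum_image hinj]

/-! ### Positively homogeneous units -/

theorem abs_le_norm_mul_iSup_unitBall {E : Type*} [NormedAddCommGroup E] [NormedSpace ℝ E]
    {H : E → ℝ} (hhom : ∀ (c : ℝ) (w : E), 0 ≤ c → H (c • w) = c * H w)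
    (hbdd : IsBddFun fun w : {w : E // ‖w‖ ≤ 1} => H w) (w : E) :
    |H w| ≤ ‖w‖ * ⨆ w : {w : E // ‖w‖ ≤ 1}, |H w| := by
  have hw : w = ‖w‖ • (‖w‖⁻¹ • w) := by
    by_cases h : w = 0
    · simp [h]
    · rw [smul_smul, mul_inv_cancel₀ (norm_ne_zero_iff.2 h), one_smul]
  have hle : ‖‖w‖⁻¹ • w‖ ≤ 1 := by
    rw [norm_smul, norm_inv, norm_norm]
    exact inv_mul_le_one
  calc |H w| = ‖w‖ * |H (‖w‖⁻¹ • w)| := by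
        conv_lhs => rw [hw, hhom _ _ (norm_nonneg _), abs_mul, abs_norm]
    _ ≤ _ := mul_le_mul_of_nonneg_left
        (le_ciSup hbdd.abs.bddAbove ⟨‖w‖⁻¹ • w, hle⟩) (norm_nonneg _)

theorem abs_sum_mul_le_of_abs_le_norm_mul {E : Type*} [NormedAddCommGroup E] {k : ℕ}
    {H : E → ℝ} {S R D : ℝ} (hS : 0 ≤ S) (hR : 0 ≤ R) (hD : 0 ≤ D)
    (hH : ∀ w, |H w| ≤ ‖w‖ * S) {w : Fin k → E} {a : Fin k → ℝ}
    (hw : ∑ t, ‖w t‖ ^ 2 ≤ R ^ 2) (ha : ∑ t, a t ^ 2 ≤ D ^ 2) :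
    |∑ t, a t * H (w t)| ≤ D * R * S := by
  have hcs : ∑ t, |a t| * ‖w t‖ ≤ D * R := by
    refine abs_le_of_sq_le_sq' ?_ (by positivity) |>.2
    refine (Finset.sum_mul_sq_le_sq_mul_sq _ _ _).trans ?_
    simp only [sq_abs]
    rw [mul_pow]
    exact mul_le_mul ha hw (by positivity) (by positivity)
  calc |∑ t, a t * H (w t)| ≤ ∑ t, |a t| * ‖w t‖ * S := by
        refine (Finset.abs_sum_le_sum_abs _ _).trans (Finset.sum_le_sum fun t _ => ?_)
        rw [abs_mul, mul_assoc]
        exact mul_le_mul_of_nonneg_left (hH _) (abs_nonneg _)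
    _ = (∑ t, |a t| * ‖w t‖) * S := (Finset.sum_mul _ _ _).symm
    _ ≤ _ := mul_le_mul_of_nonneg_right hcs hS

theorem radE_iSup_unitBall_le {E : Type*} [NormedAddCommGroup E] [InnerProductSpace ℝ E] {m : ℕ}
    {σ : ℝ → ℝ} {L M C : ℝ} (hL : 0 ≤ L) (hM : 0 ≤ M) (hC : 0 ≤ C)
    (hlip : ∀ a b, |σ a - σ b| ≤ L * |a - b|) (hσ0 : σ 0 = 0)
    {g : Fin m → ℝ} (hg : ∀ j, |g j| ≤ M) {y : Fin m → E} (hy : ∀ j, ‖y j‖ ≤ C) :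
    radE m (fun ε => ⨆ w : {w : E // ‖w‖ ≤ 1}, |∑ j, ε j * (g j * σ ⟪y j, (w : E)⟫)|) ≤
      2 * (M * L * (Real.sqrt m * C)) := by
  have hinner : ∀ j, IsBddFun fun w : {w : E // ‖w‖ ≤ 1} => ⟪y j, (w : E)⟫ := fun j =>
    ⟨‖y j‖, fun w => (abs_real_inner_le_norm _ _).trans
      (mul_le_of_le_one_right (norm_nonneg _) w.2)⟩
  have hσ : ∀ a, |σ a| ≤ L * |a| := fun a => by simpa [hσ0] using hlip a 0
  refine (radE_iSup_abs_le (P := {w : E // ‖w‖ ≤ 1}) _ (fun w j => M * L * ⟪y j, (w : E)⟫)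
    (fun j => ((hinner j).of_abs_le_mul hL fun w => hσ _).const_mul _)
    (fun j => (hinner j).const_mul _) (fun j w w' => ?_) ⟨0, by simp⟩
    (fun j => by simp [hσ0])).trans ?_
  · rw [← mul_sub, ← mul_sub, abs_mul, abs_mul, abs_of_nonneg (mul_nonneg hM hL), mul_assoc]
    exact mul_le_mul (hg j) (hlip _ _) (abs_nonneg _) hM
  · refine mul_le_mul_of_nonneg_left ?_ zero_le_two
    refine le_trans ?_ (mul_le_mul_of_nonneg_left (radE_norm_sum_le y hC hy) (mul_nonneg hM hL))
    rw [← radE_const_mul]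
    have : Nonempty {w : E // ‖w‖ ≤ 1} := ⟨⟨0, by simp⟩⟩
    refine radE_mono fun ε => ciSup_le fun w => ?_
    have heq : ∑ j, ε j * (M * L * ⟪y j, (w : E)⟫) = M * L * ⟪∑ j, ε j • y j, (w : E)⟫ := by
      rw [sum_inner, Finset.mul_sum]
      refine Finset.sum_congr rfl fun j _ => ?_
      rw [real_inner_smul_left]
      ring
    rw [heq, abs_mul, abs_of_nonneg (mul_nonneg hM hL)]
    exact mul_le_mul_of_nonneg_left ((abs_real_inner_le_norm _ _).trans
      (mul_le_of_le_one_right (norm_nonneg _) w.2)) (mul_nonneg hM hL)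

/-- main theorem: Rademacher complexity bound for two-layer GCNs.
The parameters are `W¹ = (w_t¹)_{t∈[k]}` with Frobenius norm at most `R` and
`w² ∈ ℝ^k` with `‖w²‖₂ ≤ D`; the network output at node `i` is
`σ(∑_t w²_t ∑_{v ∈ N(i)} G_{iv} σ(∑_{j ∈ N(v)} G_{vj} ⟪x_j, w_t¹⟫))`. -/
theorem gcn_rademacher_upper_bound {n d k q m : ℕ} [NeZero m]
    (G : Matrix (Fin n) (Fin n) ℝ) (hGsym : G.IsSymm)
    (lam : ℝ) (hlam : lam = ‖Matrix.toEuclideanCLM (𝕜 := ℝ) G‖)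
    (N : Fin n → Finset (Fin n)) (hcard : ∀ v, (N v).card = q)
    (x : Fin n → EuclideanSpace ℝ (Fin d)) (B : ℝ) (hB : 0 < B)
    (hx : ∀ j, ‖x j‖ ≤ B)
    (σ : ℝ → ℝ) (L : ℝ) (hL : 0 < L)
    (hlip : ∀ a b : ℝ, |σ a - σ b| ≤ L * |a - b|) (hσ0 : σ 0 = 0)
    (hhom : ∀ α z : ℝ, 0 ≤ α → σ (α * z) = α * σ z)
    (R D : ℝ) (hR : 0 < R) (hD : 0 < D)
    (s : Fin m → Fin n) (nl : Fin q → Fin m → Fin n)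
    (hnl : ∀ j : Fin m, ∀ v : Fin n, v ∈ N (s j) ↔ ∃ l : Fin q, nl l j = v) :
    radE m (fun ε => (1 / m) *
        ⨆ p : {p : (Fin k → EuclideanSpace ℝ (Fin d)) × (Fin k → ℝ) //
            ∑ t : Fin k, ‖p.1 t‖ ^ 2 ≤ R ^ 2 ∧ ∑ t : Fin k, (p.2 t) ^ 2 ≤ D ^ 2},
          |∑ j : Fin m, ε j *
            σ (∑ t : Fin k, (p : (Fin k → EuclideanSpace ℝ (Fin d)) × (Fin k → ℝ)).2 t *
              ∑ v ∈ N (s j), G (s j) v *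
                σ (∑ u ∈ N v, G v u * ⟪x u, (p : (Fin k → EuclideanSpace ℝ (Fin d)) × (Fin k → ℝ)).1 t⟫))|)
    ≤ 8 * L ^ 2 * B * D * R * lam * Real.sqrt (q / m) *
        ∑ l : Fin q, Finset.univ.sup' Finset.univ_nonempty
          (fun j : Fin m => |G (s j) (nl l j)|) := by
  set P := {p : (Fin k → EuclideanSpace ℝ (Fin d)) × (Fin k → ℝ) //
    ∑ t : Fin k, ‖p.1 t‖ ^ 2 ≤ R ^ 2 ∧ ∑ t : Fin k, (p.2 t) ^ 2 ≤ D ^ 2}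
  let y : Fin n → EuclideanSpace ℝ (Fin d) := fun v => ∑ u ∈ N v, G v u • x u
  let M : Fin q → ℝ := fun l => Finset.univ.sup' Finset.univ_nonempty
    (fun j : Fin m => |G (s j) (nl l j)|)
  let H : Fin q → (Fin m → ℝ) → EuclideanSpace ℝ (Fin d) → ℝ := fun l ε w =>
    ∑ j, ε j * (G (s j) (nl l j) * σ ⟪y (nl l j), w⟫)
  let S : Fin q → (Fin m → ℝ) → ℝ := fun l ε =>
    ⨆ w : {w : EuclideanSpace ℝ (Fin d) // ‖w‖ ≤ 1}, |H l ε w|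
  let g : P → Fin m → ℝ := fun p j =>
    ∑ t, p.1.2 t * ∑ v ∈ N (s j), G (s j) v * σ ⟪y v, p.1.1 t⟫
  have hσ : ∀ a, |σ a| ≤ L * |a| := fun a => by simpa [hσ0] using hlip a 0
  have hM : ∀ l j, |G (s j) (nl l j)| ≤ M l := fun l j =>
    Finset.le_sup' (fun j : Fin m => |G (s j) (nl l j)|) (Finset.mem_univ j)
  have hM0 : ∀ l, 0 ≤ M l := fun l => (abs_nonneg _).trans (hM l 0)
  have hlam0 : 0 ≤ lam := hlam ▸ norm_nonneg _
  have hy : ∀ v, ‖y v‖ ≤ Real.sqrt q * lam * B := fun v => by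
    rw [hlam]
    exact norm_aggregate_le hGsym (hcard v) hB.le hx v
  have hinner : ∀ v w, ∑ u ∈ N v, G v u * ⟪x u, w⟫ = ⟪y v, w⟫ := fun v w => by
    simp only [y, sum_inner, real_inner_smul_left]
  have hw_bdd : ∀ v t, IsBddFun fun p : P => ⟪y v, p.1.1 t⟫ := fun v t => by
    refine ⟨‖y v‖ * R, fun p => (abs_real_inner_le_norm _ _).trans ?_⟩
    refine mul_le_mul_of_nonneg_left ?_ (norm_nonneg _)
    refine abs_le_of_sq_le_sq' ?_ hR.le |>.2
    exact (Finset.single_le_sum (f := fun t => ‖p.1.1 t‖ ^ 2) (fun _ _ => sq_nonneg _)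
      (Finset.mem_univ t)).trans p.2.1
  have ha_bdd : ∀ t, IsBddFun fun p : P => p.1.2 t := fun t => by
    refine ⟨D, fun p => abs_le_of_sq_le_sq ?_ hD.le⟩
    exact (Finset.single_le_sum (f := fun t => p.1.2 t ^ 2) (fun _ _ => sq_nonneg _)
      (Finset.mem_univ t)).trans p.2.2
  have hg_bdd : ∀ j, IsBddFun fun p => g p j := fun j =>
    IsBddFun.sum _ fun t => (ha_bdd t).mul <| IsBddFun.sum _ fun v =>
      ((hw_bdd v t).of_abs_le_mul hL.le fun p => hσ _).const_mul _
  let p₀ : P := ⟨0, by simp [sq_nonneg]⟩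
  have : Nonempty P := ⟨p₀⟩
  have hH_bdd : ∀ l ε, IsBddFun fun w : {w : EuclideanSpace ℝ (Fin d) // ‖w‖ ≤ 1} =>
      H l ε w := fun l ε =>
    IsBddFun.sum _ fun j => (IsBddFun.const_mul _ <| IsBddFun.of_abs_le_mul hL.le
      (f := fun w : {w : EuclideanSpace ℝ (Fin d) // ‖w‖ ≤ 1} => ⟪y (nl l j), w.1⟫)
      ⟨‖y (nl l j)‖, fun w => (abs_real_inner_le_norm _ _).trans
        (mul_le_of_le_one_right (norm_nonneg _) w.2)⟩ fun w => hσ _).const_mul _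
  have hH_hom : ∀ l ε (c : ℝ) w, 0 ≤ c → H l ε (c • w) = c * H l ε w := by
    intro l ε c w hc
    simp only [H, Finset.mul_sum, real_inner_smul_right, hhom c _ hc]
    exact Finset.sum_congr rfl fun j _ => by ring
  have hS0 : ∀ l ε, 0 ≤ S l ε := fun l ε => Real.iSup_nonneg fun w => abs_nonneg _
  have hg_eq : ∀ (ε : Fin m → ℝ) (p : P),
      ∑ j, ε j * (L * g p j) = L * ∑ l, ∑ t, p.1.2 t * H l ε (p.1.1 t) := by
    intro ε p
    have hrow : ∀ j, g p j =
        ∑ l, ∑ t, p.1.2 t * (G (s j) (nl l j) * σ ⟪y (nl l j), p.1.1 t⟫) := fun j => by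
      rw [Finset.sum_comm]
      refine Finset.sum_congr rfl fun t _ => ?_
      rw [sum_eq_sum_enumeration (hcard _) (fun l => nl l j) (hnl j), Finset.mul_sum]
    simp only [hrow, H, Finset.mul_sum]
    rw [Finset.sum_comm]
    refine Finset.sum_congr rfl fun l _ => ?_
    rw [Finset.sum_comm]
    exact Finset.sum_congr rfl fun t _ => Finset.sum_congr rfl fun j _ => by ring
  have houter : radE m (fun ε => ⨆ p : P, |∑ j, ε j * σ (g p j)|) ≤
      2 * radE m (fun ε => ⨆ p : P, |∑ j, ε j * (L * g p j)|) := by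
    refine radE_iSup_abs_le _ _
      (fun j => (hg_bdd j).of_abs_le_mul hL.le fun p => hσ _)
      (fun j => (hg_bdd j).const_mul _) (fun j p p' => ?_) p₀
      (fun j => by simp [g, p₀, hσ0])
    rw [← mul_sub, abs_mul, abs_of_pos hL]
    exact hlip _ _
  have hpeel : radE m (fun ε => ⨆ p : P, |∑ j, ε j * (L * g p j)|) ≤
      radE m (fun ε => L * (D * R) * ∑ l, S l ε) := by
    refine radE_mono fun ε => ciSup_le fun p => ?_
    rw [hg_eq, abs_mul, abs_of_pos hL, mul_assoc, Finset.mul_sum]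
    refine mul_le_mul_of_nonneg_left ?_ hL.le
    refine (Finset.abs_sum_le_sum_abs _ _).trans (Finset.sum_le_sum fun l _ => ?_)
    exact abs_sum_mul_le_of_abs_le_norm_mul (hS0 l ε) hR.le hD.le
      (abs_le_norm_mul_iSup_unitBall (hH_hom l ε) (hH_bdd l ε)) p.2.1 p.2.2
  have hS : ∀ l, radE m (S l) ≤
      2 * (M l * L * (Real.sqrt m * (Real.sqrt q * lam * B))) := fun l =>
    radE_iSup_unitBall_le hL.le (hM0 l) (by positivity) hlip hσ0 (hM l) fun j => hy _
  have hsum : ∑ l, radE m (S l) ≤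
      2 * (L * (Real.sqrt m * (Real.sqrt q * lam * B))) * ∑ l, M l := by
    rw [Finset.mul_sum]
    exact Finset.sum_le_sum fun l _ => (hS l).trans_eq (by ring)
  rw [radE_const_mul, radE_sum] at hpeel
  have hm : (0 : ℝ) < m := Nat.cast_pos.2 (Nat.pos_of_ne_zero (NeZero.ne m))
  have hsqrt : 1 / (m : ℝ) * Real.sqrt m * Real.sqrt q = Real.sqrt (q / m) := by
    rw [Real.sqrt_div (Nat.cast_nonneg _)]
    have := Real.sqrt_pos.2 hm
    field_simp
    rw [Real.sq_sqrt hm.le]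
  simp only [hinner]
  rw [radE_const_mul]
  change 1 / (m : ℝ) * radE m (fun ε => ⨆ p : P, |∑ j, ε j * σ (g p j)|) ≤
    8 * L ^ 2 * B * D * R * lam * Real.sqrt (q / m) * ∑ l, M l
  have hMsum : 0 ≤ ∑ l, M l := Finset.sum_nonneg fun l _ => hM0 l
  have hLDR : 0 ≤ L * (D * R) := by positivity
  calc 1 / (m : ℝ) * radE m (fun ε => ⨆ p : P, |∑ j, ε j * σ (g p j)|)
      ≤ 1 / (m : ℝ) * (2 * (L * (D * R) *
          (2 * (L * (Real.sqrt m * (Real.sqrt q * lam * B))) * ∑ l, M l))) := by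
        refine mul_le_mul_of_nonneg_left ?_ (by positivity)
        linarith [mul_le_mul_of_nonneg_left hsum hLDR]
    _ = 4 * (L ^ 2 * B * D * R * lam * Real.sqrt (q / m) * ∑ l, M l) := by
        rw [← hsqrt]
        ring
    _ ≤ 8 * (L ^ 2 * B * D * R * lam * Real.sqrt (q / m) * ∑ l, M l) :=
        mul_le_mul_of_nonneg_right (by norm_num) (by positivity)
    _ = _ := by ring
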